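/- arXiv:2411.02415 — 3 statements merged into one kernel-verified Lean document; each statement's English description precedes it below -/
import Mathlib

section
/- Let n ≥ 1, let d'_1, …, d'_n be positive real numbers and d_1, …, d_n be nonnegative real numbers, and define g : ℝ → ℝ by g(z) = Σ_{i=1}^n d'_i · |z − d_i|. Suppose that for every choice of signs ε_1, …, ε_n ∈ {−1, +1} one has Σ_{i=1}^n ε_i d'_i ≠ 0. Then g has exactly one global minimizer: there exists a unique z* ∈ ℝ with g(z*) ≤ g(z) for all z ∈ ℝ. -/
open Filter in
/-- A nonempty weighted sum of absolute deviations with positive weights tends to infinity. -/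
theorem tendsto_sum_mul_abs_sub_cocompact {ι : Type*} [Fintype ι] [Nonempty ι] (w d : ι → ℝ)
    (hw : ∀ i, 0 < w i) :
    Tendsto (fun z : ℝ => ∑ i, w i * |z - d i|) (cocompact ℝ) atTop := by
  obtain ⟨i⟩ := ‹Nonempty ι›
  refine tendsto_atTop_mono
    (fun z => Finset.single_le_sum (f := fun j => w j * |z - d j|)
      (fun j _ => mul_nonneg (hw j).le (abs_nonneg _)) (Finset.mem_univ i)) ?_
  exact Tendsto.const_mul_atTop (hw i) (tendsto_dist_right_cocompact_atTop (d i))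

theorem convexOn_sum_mul_abs_sub {ι : Type*} [Fintype ι] (w d : ι → ℝ) (hw : ∀ i, 0 ≤ w i) :
    ConvexOn ℝ Set.univ (fun z : ℝ => ∑ i, w i * |z - d i|) := by
  refine ⟨convex_univ, fun x _ y _ a b ha hb hab => ?_⟩
  simp only [smul_eq_mul, Finset.mul_sum, ← Finset.sum_add_distrib]
  refine Finset.sum_le_sum fun i _ => ?_
  have hd : a * x + b * y - d i = a * (x - d i) + b * (y - d i) := by
    linear_combination d i * hab
  calc w i * |a * x + b * y - d i|
      ≤ w i * (|a * (x - d i)| + |b * (y - d i)|) := by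
        rw [hd]
        exact mul_le_mul_of_nonneg_left (abs_add_le _ _) (hw i)
    _ = a * (w i * |x - d i|) + b * (w i * |y - d i|) := by
        rw [abs_mul, abs_mul, abs_of_nonneg ha, abs_of_nonneg hb]
        ring

/-- Away from the breakpoints, the derivative of a weighted sum of absolute deviations is a
signed sum of the weights. -/
theorem hasDerivAt_sum_mul_abs_sub {ι : Type*} [Fintype ι] (w d : ι → ℝ) {m : ℝ}
    (hm : m ∉ Set.range d) :
    HasDerivAt (fun z : ℝ => ∑ i, w i * |z - d i|)
      (∑ i, (SignType.sign (m - d i) : ℝ) * w i) m := by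
  refine HasDerivAt.fun_sum fun i _ => ?_
  have hne : m - d i ≠ 0 := sub_ne_zero.2 fun h => hm ⟨i, h.symm⟩
  have h := ((hasDerivAt_abs hne).comp m ((hasDerivAt_id m).sub_const (d i))).const_mul (w i)
  rw [mul_one, mul_comm] at h
  exact h

/-- If no signed sum of the weights vanishes, a weighted sum of absolute deviations does not have
two global minimizers `x < y`. -/
theorem not_lt_of_minimizers_sum_mul_abs_sub {ι : Type*} [Fintype ι] (w d : ι → ℝ)
    (hw : ∀ i, 0 ≤ w i)
    (hsign : ∀ ε : ι → ℝ, (∀ i, ε i = 1 ∨ ε i = -1) → ∑ i, ε i * w i ≠ 0) {x y : ℝ}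
    (hx : ∀ z, ∑ i, w i * |x - d i| ≤ ∑ i, w i * |z - d i|)
    (hy : ∀ z, ∑ i, w i * |y - d i| ≤ ∑ i, w i * |z - d i|) : ¬ x < y := by
  intro hxy
  obtain ⟨m, hm, hmd⟩ := (Set.Ioo_infinite hxy).exists_notMem_finite (Set.finite_range d)
  have hmin : ∀ z, ∑ i, w i * |m - d i| ≤ ∑ i, w i * |z - d i| := fun z =>
    ((convexOn_sum_mul_abs_sub w d hw).le_max_of_mem_Icc (Set.mem_univ x) (Set.mem_univ y)
      ⟨hm.1.le, hm.2.le⟩).trans (max_le (hx z) (hy z))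
  refine hsign (fun i => (SignType.sign (m - d i) : ℝ)) (fun i => ?_)
    (IsLocalMin.hasDerivAt_eq_zero (Filter.Eventually.of_forall hmin)
      (hasDerivAt_sum_mul_abs_sub w d hmd))
  rcases lt_or_gt_of_ne (fun h : m = d i => hmd ⟨i, h.symm⟩) with h | h
  · exact Or.inr (by simp [sign_neg (sub_neg.2 h)])
  · exact Or.inl (by simp [sign_pos (sub_pos.2 h)])

/-- If no signed sum `±d'_1 ± ⋯ ± d'_n` vanishes, then
`g z = ∑ i, d' i * |z - d i|` has exactly one global minimizer. -/
theorem existsUnique_minimizer_of_signed_sums_ne_zero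
    (n : ℕ) (hn : 1 ≤ n) (d' d : Fin n → ℝ)
    (hd' : ∀ i, 0 < d' i) (hd : ∀ i, 0 ≤ d i)
    (g : ℝ → ℝ) (hg : ∀ z, g z = ∑ i, d' i * |z - d i|)
    (hsign : ∀ ε : Fin n → ℝ, (∀ i, ε i = 1 ∨ ε i = -1) → (∑ i, ε i * d' i) ≠ 0) :
    ∃! zstar : ℝ, ∀ z : ℝ, g zstar ≤ g z := by
  have : Nonempty (Fin n) := ⟨⟨0, hn⟩⟩
  obtain rfl : g = fun z => ∑ i, d' i * |z - d i| := funext hg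
  have hcont : Continuous fun z : ℝ => ∑ i, d' i * |z - d i| := by fun_prop
  obtain ⟨x, hx⟩ := hcont.exists_forall_le (tendsto_sum_mul_abs_sub_cocompact d' d hd')
  have hnlt := @not_lt_of_minimizers_sum_mul_abs_sub _ _ d' d (fun i => (hd' i).le) hsign
  exact ⟨x, hx, fun y hy => le_antisymm (not_lt.1 (hnlt hx hy)) (not_lt.1 (hnlt hy hx))⟩
end

section
/- Let N ≥ 1, let α_1, …, α_N, β_1, …, β_N and γ_1, …, γ_{N+1} all be positive reals, let ᾱ_1, …, ᾱ_N and β̄_1, …, β̄_N be reals, and let z_0, z_{N+1} be fixed reals. Define f : ℝ^N → ℝ by f(z) = Σ_{i=1}^N ( α_i |z_i − ᾱ_i| + β_i |z_i − β̄_i| ) + Σ_{i=1}^{N+1} γ_i |z_i − z_{i−1}|, where in the second sum z_0 and z_{N+1} denote the fixed constants. Let 𝒵 = {ᾱ_1, …, ᾱ_N, β̄_1, …, β̄_N, z_0, z_{N+1}}. If z* ∈ ℝ^N is the unique global minimizer of f (f(z*) ≤ f(z) for all z, and every global minimizer equals z*), then every component satisfies z*_i ∈ 𝒵 for i = 1,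 …, N. -/
/-- The vector `z ∈ ℝ^N` extended by the fixed boundary constants `z0` (at index 0)
and `zN1` (at index N+1). -/
noncomputable def extVec (N : ℕ) (z0 zN1 : ℝ) (z : Fin N → ℝ) : Fin (N + 2) → ℝ :=
  fun j =>
    if h0 : (j : ℕ) = 0 then z0
    else if hN : (j : ℕ) = N + 1 then zN1
    else z ⟨(j : ℕ) - 1, by omega⟩

/-- The global optimal reference field objective
`f z = ∑_{i=1}^N (α_i |z_i − ᾱ_i| + β_i |z_i − β̄_i|) + ∑_{i=1}^{N+1} γ_i |z_i − z_{i−1}|`,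
where `z_0` and `z_{N+1}` in the last sum are the fixed constants. -/
noncomputable def objF (N : ℕ) (al be : Fin N → ℝ) (ga : Fin (N + 1) → ℝ)
    (alb bbb : Fin N → ℝ) (z0 zN1 : ℝ) (z : Fin N → ℝ) : ℝ :=
  (∑ i : Fin N, (al i * |z i - alb i| + be i * |z i - bbb i|)) +
    ∑ j : Fin (N + 1),
      ga j * |extVec N z0 zN1 z j.succ - extVec N z0 zN1 z j.castSucc|

open Classical in
/-- Move the point `v` to `v + s` and fix every other real. -/
noncomputable def shiftAt (v s x : ℝ) : ℝ := if x = v then x + s else x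

lemma shiftAt_self (v s : ℝ) : shiftAt v s v = v + s := if_pos rfl

lemma shiftAt_of_ne {v x : ℝ} (s : ℝ) (h : x ≠ v) : shiftAt v s x = x := if_neg h

lemma abs_add_add_abs_sub_of_le {t a : ℝ} (ht : 0 ≤ t) (h : t ≤ |a|) :
    |a + t| + |a - t| = 2 * |a| := by
  rcases abs_cases a with ⟨ha, _⟩ | ⟨ha, _⟩
  · rw [abs_of_nonneg (by linarith : 0 ≤ a + t), abs_of_nonneg (by linarith : 0 ≤ a - t)]
    linarith
  · rw [abs_of_nonpos (by linarith : a + t ≤ 0), abs_of_nonpos (by linarith : a - t ≤ 0)]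
    linarith

lemma abs_shiftAt_sub_shiftAt_add {v t x y : ℝ} (ht : 0 ≤ t)
    (hx : x ≠ v → t ≤ |x - v|) (hy : y ≠ v → t ≤ |y - v|) :
    |shiftAt v t x - shiftAt v t y| + |shiftAt v (-t) x - shiftAt v (-t) y| =
      2 * |x - y| := by
  by_cases hxv : x = v <;> by_cases hyv : y = v
  · simp [hxv, hyv]
  · subst hxv
    rw [shiftAt_self, shiftAt_self, shiftAt_of_ne _ hyv, shiftAt_of_ne _ hyv,
      ← abs_add_add_abs_sub_of_le ht (abs_sub_comm y x ▸ hy hyv)]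
    ring_nf
  · subst hyv
    rw [shiftAt_self, shiftAt_self, shiftAt_of_ne _ hxv, shiftAt_of_ne _ hxv,
      ← abs_add_add_abs_sub_of_le ht (hx hxv)]
    ring_nf
  · simp only [shiftAt_of_ne _ hxv, shiftAt_of_ne _ hyv]
    ring

lemma Set.Finite.exists_pos_le_abs_sub {P : Set ℝ} (hP : P.Finite) (v : ℝ) :
    ∃ t > 0, ∀ p ∈ P, p ≠ v → t ≤ |p - v| := by
  have hmem : (P \ {v})ᶜ ∈ nhds v := hP.sdiff.isClosed.isOpen_compl.mem_nhds (by simp)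
  obtain ⟨t, ht, hball⟩ := Metric.mem_nhds_iff.mp hmem
  refine ⟨t, ht, fun p hp hpv => not_lt.mp fun hlt => ?_⟩
  exact hball (by rwa [Metric.mem_ball, Real.dist_eq]) ⟨hp, hpv⟩

lemma extVec_comp {N : ℕ} {z0 zN1 : ℝ} {g : ℝ → ℝ} (h0 : g z0 = z0) (h1 : g zN1 = zN1)
    (z : Fin N → ℝ) (j : Fin (N + 2)) :
    extVec N z0 zN1 (g ∘ z) j = g (extVec N z0 zN1 z j) := by
  unfold extVec
  split_ifs <;> simp [h0, h1]

lemma extVec_mem {N : ℕ} {z0 zN1 : ℝ} (z : Fin N → ℝ) (j : Fin (N + 2)) :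
    extVec N z0 zN1 z j ∈ Set.range z ∪ {z0, zN1} := by
  unfold extVec
  split_ifs <;> simp

lemma objF_shiftAt_add_objF_shiftAt_neg {N : ℕ} (al be : Fin N → ℝ) (ga : Fin (N + 1) → ℝ)
    {alb bbb : Fin N → ℝ} {z0 zN1 : ℝ} (z : Fin N → ℝ) {v t : ℝ} (ht : 0 ≤ t)
    (hv : v ∉ Set.range alb ∪ Set.range bbb ∪ {z0, zN1})
    (hsep : ∀ p ∈ Set.range alb ∪ Set.range bbb ∪ {z0, zN1} ∪ Set.range z,
      p ≠ v → t ≤ |p - v|) :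
    objF N al be ga alb bbb z0 zN1 (shiftAt v t ∘ z) +
        objF N al be ga alb bbb z0 zN1 (shiftAt v (-t) ∘ z) =
      2 * objF N al be ga alb bbb z0 zN1 z := by
  have hfix : ∀ s, ∀ p ∈ Set.range alb ∪ Set.range bbb ∪ {z0, zN1}, shiftAt v s p = p :=
    fun s p hp => shiftAt_of_ne s fun h => hv (h ▸ hp)
  have hkey : ∀ x ∈ Set.range alb ∪ Set.range bbb ∪ {z0, zN1} ∪ Set.range z,
      ∀ y ∈ Set.range alb ∪ Set.range bbb ∪ {z0, zN1} ∪ Set.range z,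
      |shiftAt v t x - shiftAt v t y| + |shiftAt v (-t) x - shiftAt v (-t) y| =
        2 * |x - y| :=
    fun x hx y hy => abs_shiftAt_sub_shiftAt_add ht (hsep x hx) (hsep y hy)
  have hext : ∀ s j, extVec N z0 zN1 (shiftAt v s ∘ z) j =
      shiftAt v s (extVec N z0 zN1 z j) :=
    fun s => extVec_comp (hfix s z0 (by simp)) (hfix s zN1 (by simp)) z
  have hextmem : ∀ j, extVec N z0 zN1 z j ∈
      Set.range alb ∪ Set.range bbb ∪ {z0, zN1} ∪ Set.range z := fun j =>
    (extVec_mem z j).elim Or.inr fun h => Or.inl (Or.inr h)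
  unfold objF
  rw [add_add_add_comm, ← Finset.sum_add_distrib, ← Finset.sum_add_distrib, mul_add,
    Finset.mul_sum, Finset.mul_sum]
  congr 1
  · refine Finset.sum_congr rfl fun i _ => ?_
    have ha := hkey (z i) (by simp) (alb i) (by simp)
    have hb := hkey (z i) (by simp) (bbb i) (by simp)
    simp only [hfix _ (alb i) (by simp)] at ha
    simp only [hfix _ (bbb i) (by simp)] at hb
    simp only [Function.comp_apply]
    linear_combination al i * ha + be i * hb
  · refine Finset.sum_congr rfl fun j _ => ?_
    simp only [hext]
    linear_combination ga j * hkey _ (hextmem j.succ) _ (hextmem j.castSucc)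

/-- with all coefficients positive, every component of the unique global
minimizer of the objective `f` lies in the finite candidate set
`𝒵 = {ᾱ_1, …, ᾱ_N, β̄_1, …, β̄_N, z_0, z_{N+1}}`. -/
theorem unique_minimizer_components_mem_candidate_set
    (N : ℕ) (hN : 1 ≤ N)
    (al be : Fin N → ℝ) (ga : Fin (N + 1) → ℝ)
    (alb bbb : Fin N → ℝ) (z0 zN1 : ℝ)
    (hal : ∀ i, 0 < al i) (hbe : ∀ i, 0 < be i) (hga : ∀ i, 0 < ga i)
    (zstar : Fin N → ℝ)
    (hmin : ∀ z : Fin N → ℝ,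
      objF N al be ga alb bbb z0 zN1 zstar ≤ objF N al be ga alb bbb z0 zN1 z)
    (huniq : ∀ y : Fin N → ℝ,
      (∀ z : Fin N → ℝ,
        objF N al be ga alb bbb z0 zN1 y ≤ objF N al be ga alb bbb z0 zN1 z) →
      y = zstar) :
    ∀ i : Fin N,
      zstar i ∈ Set.range alb ∪ Set.range bbb ∪ {z0, zN1} := by
  intro i
  by_contra hv
  have hfin : (Set.range alb ∪ Set.range bbb ∪ {z0, zN1} ∪ Set.range zstar).Finite :=
    (((Set.finite_range alb).union (Set.finite_range bbb)).union (Set.toFinite _)).union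
      (Set.finite_range zstar)
  obtain ⟨t, ht, hsep⟩ := hfin.exists_pos_le_abs_sub (zstar i)
  have hsum := objF_shiftAt_add_objF_shiftAt_neg al be ga zstar ht.le hv hsep
  have heq := huniq (shiftAt (zstar i) t ∘ zstar) fun z => by
    linarith [hmin z, hmin (shiftAt (zstar i) (-t) ∘ zstar)]
  have hi := congrFun heq i
  rw [Function.comp_apply, shiftAt_self] at hi
  linarith
end

section
/- Let c, σ_p, Δt be positive reals and let α, β, σ̃_p, U_n, U_{n+1}, Ũ, R be reals with 1 + α·c·β·σ_p·Δt ≠ 0. Define Ū = α·U_{n+1} + (1 − α)·U_n and f = 1/(1 + α·c·β·σ_p·Δt). If (U_{n+1} − U_n)/Δt = β·( R − σ_p·c·Ū + σ̃_p·c·Ũ ), then Ū = f·U_n + (1 − f)·R/(c·σ_p) + (1 − f)·(σ̃_p/σ_p)·Ũ. -/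
/-- the IMC time-averaged equilibrium radiation energy density
identity: from `Ū = α U_{n+1} + (1−α) U_n`, the Fleck factor
`f = 1/(1 + α c β σ_p Δt)` and the discrete balance equation
`(U_{n+1} − U_n)/Δt = β (R − σ_p c Ū + σ̃_p c Ũ)`, it follows that
`Ū = f U_n + (1−f) R/(c σ_p) + (1−f)(σ̃_p/σ_p) Ũ`. -/
theorem IMC_time_averaged_identity
    (c σp Δt : ℝ) (hc : 0 < c) (hσp : 0 < σp) (hΔt : 0 < Δt)
    (α β σtp Un Un1 Ut R : ℝ)
    (hden : 1 + α * c * β * σp * Δt ≠ 0)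
    (Ub f : ℝ)
    (hUb : Ub = α * Un1 + (1 - α) * Un)
    (hf : f = 1 / (1 + α * c * β * σp * Δt))
    (heq : (Un1 - Un) / Δt = β * (R - σp * c * Ub + σtp * c * Ut)) :
    Ub = f * Un + (1 - f) * R / (c * σp) + (1 - f) * (σtp / σp) * Ut := by
  have hc' : c ≠ 0 := hc.ne'
  have hσ' : σp ≠ 0 := hσp.ne'
  rw [div_eq_iff hΔt.ne'] at heq
  have hfD : f * (1 + α * c * β * σp * Δt) = 1 := by rw [hf, one_div_mul_cancel hden]
  have h1f : 1 - f = f * (α * c * β * σp * Δt) := by linear_combination -hfD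
  have hR : (1 - f) * R / (c * σp) = f * (α * β * Δt) * R := by
    rw [h1f]; field_simp
  have hU : (1 - f) * (σtp / σp) * Ut = f * (α * β * Δt) * (σtp * c * Ut) := by
    rw [h1f]; field_simp
  rw [hR, hU]
  linear_combination f * hUb + f * α * heq - Ub * hfD
end
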